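/- Let A and B be two disjoint nonempty compact, path-connected, and orthogonally convex sets in ℝ². Then there exists a staircase line strictly separating A and B. -/

import Mathlib

/-- A set `S ⊆ ℝⁿ` is orthogonally convex if its intersection with every
axis-aligned line is connected (possibly empty, i.e. preconnected). -/
def OrthoConvex {n : ℕ} (S : Set (EuclideanSpace ℝ (Fin n))) : Prop :=
  ∀ (i : Fin n) (c : EuclideanSpace ℝ (Fin n)),
    IsPreconnected {p ∈ S | ∀ j, j ≠ i → p j = c j}

/-- The ray issuing from `p` through `q`. -/
def Ray (p q : EuclideanSpace ℝ (Fin 2)) : Set (EuclideanSpace ℝ (Fin 2)) :=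
  {x | ∃ t : ℝ, 0 ≤ t ∧ x = p + t • (q - p)}

/-- `L ⊆ ℝ²` is a staircase line if it is obtained from a simple polyline
`v₀v₁…vₙ` made of nondegenerate axis-aligned segments, in which all step
vectors with odd index have the same direction and all step vectors with even
index have the same direction, by replacing the first segment `v₀v₁` by the
ray from `v₁` through `v₀` and the last segment `v_{n-1}vₙ` by the ray from
`v_{n-1}` through `vₙ`.  Simplicity of the resulting curve is expressed by the
existence of an injective continuous parametrization of `L` by `ℝ`. -/
def IsStaircaseLine (L : Set (EuclideanSpace ℝ (Fin 2))) : Prop :=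
  ∃ (n : ℕ) (v : ℕ → EuclideanSpace ℝ (Fin 2)), 1 ≤ n ∧
    (∀ i : ℕ, 1 ≤ i → i ≤ n →
      v (i - 1) ≠ v i ∧ ((v (i - 1)) 0 = (v i) 0 ∨ (v (i - 1)) 1 = (v i) 1)) ∧
    (∀ i j : ℕ, 1 ≤ i → i ≤ n → 1 ≤ j → j ≤ n → i % 2 = j % 2 →
      ∃ t : ℝ, 0 < t ∧ v j - v (j - 1) = t • (v i - v (i - 1))) ∧
    (∃ φ : ℝ → EuclideanSpace ℝ (Fin 2),
      Continuous φ ∧ Function.Injective φ ∧ Set.range φ = L) ∧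
    L = Ray (v 1) (v 0) ∪ Ray (v (n - 1)) (v n) ∪
      ⋃ i ∈ Set.Ico 1 (n - 1), segment ℝ (v i) (v (i + 1))

/-- A staircase-halfplane is a closed subset of `ℝ²` whose boundary is a
staircase line. -/
def IsStaircaseHalfplane (H : Set (EuclideanSpace ℝ (Fin 2))) : Prop :=
  IsClosed H ∧ IsStaircaseLine (frontier H)

/-- A staircase line `L` strictly separates `A` and `B` if of the two
staircase-halfplanes bounded by `L` (whose union is the plane) one contains
`A` and the other contains `B`, and neither `A` nor `B` meets `L`. -/
def StrictlySeparates (L A B : Set (EuclideanSpace ℝ (Fin 2))) : Prop :=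
  IsStaircaseLine L ∧
    ∃ H₁ H₂ : Set (EuclideanSpace ℝ (Fin 2)),
      IsStaircaseHalfplane H₁ ∧ IsStaircaseHalfplane H₂ ∧
      frontier H₁ = L ∧ frontier H₂ = L ∧ H₁ ∪ H₂ = Set.univ ∧
      A ⊆ H₁ ∧ B ⊆ H₂ ∧ Disjoint A L ∧ Disjoint B L

local notation "E2" => EuclideanSpace ℝ (Fin 2)

lemma coordCont (i : Fin 2) : Continuous (fun p : E2 => p i) := by fun_prop

lemma fibre_between {A : Set E2} (hA : OrthoConvex A) {i j : Fin 2} (hij : j ≠ i)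
    {a a' q : E2} (ha : a ∈ A) (ha' : a' ∈ A) (h1 : a j = q j) (h2 : a' j = q j)
    (h3 : a i ≤ q i) (h4 : q i ≤ a' i) : q ∈ A := by
  have hall : ∀ k : Fin 2, k = i ∨ k = j := by
    intro k; fin_cases k <;> fin_cases i <;> fin_cases j <;> simp_all
  have hp := hA i q
  have hm : ∀ p ∈ A, p j = q j → p ∈ {p ∈ A | ∀ k, k ≠ i → p k = q k} := by
    intro p hp hpj
    refine ⟨hp, fun k hk => ?_⟩
    rcases hall k with h | h
    · exact absurd h hk
    · rw [h, hpj]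
  have := hp.intermediate_value (hm a ha h1) (hm a' ha' h2) (coordCont i).continuousOn ⟨h3, h4⟩
  obtain ⟨p, ⟨hpA, hpk⟩, hpi⟩ := this
  have : p = q := by
    ext k
    by_cases hk : k = i
    · rw [hk]; exact hpi
    · exact hpk k hk
  exact this ▸ hpA

lemma no_cross {A B : Set E2} (hA : OrthoConvex A) (hB : OrthoConvex B) (hd : Disjoint A B)
    {i j : Fin 2} (hij : j ≠ i) {a b a' b' : E2} (ha : a ∈ A) (hb : b ∈ B) (ha' : a' ∈ A)
    (hb' : b' ∈ B) (t : ℝ) (h1 : a j = t) (h2 : b j = t) (h3 : a' j = t) (h4 : b' j = t)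
    (h5 : a i ≤ b i) (h6 : b' i ≤ a' i) : False := by
  rcases le_total (a i) (b' i) with h | h
  · exact Set.disjoint_left.1 hd
      (fibre_between hA hij ha ha' (h1.trans h4.symm) (h3.trans h4.symm) h h6) hb'
  · exact Set.disjoint_left.1 hd ha
      (fibre_between hB hij hb' hb (h4.trans h1.symm) (h2.trans h1.symm) h h5)

lemma closed_T {A B : Set E2} (hA : IsCompact A) (hB : IsCompact B) (i j : Fin 2) :
    IsClosed {t : ℝ | ∃ a ∈ A, ∃ b ∈ B, a j = t ∧ b j = t ∧ a i ≤ b i} := by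
  have hc : IsCompact ((A ×ˢ B) ∩ {p : E2 × E2 | p.1 j = p.2 j ∧ p.1 i ≤ p.2 i}) := by
    apply (hA.prod hB).inter_right
    have k1 : IsClosed {p : E2 × E2 | p.1 j = p.2 j} := isClosed_eq (by fun_prop) (by fun_prop)
    have k2 : IsClosed {p : E2 × E2 | p.1 i ≤ p.2 i} := isClosed_le (by fun_prop) (by fun_prop)
    exact k1.inter k2
  have := (hc.image (f := fun p : E2 × E2 => p.1 j) (by fun_prop)).isClosed
  convert this using 1
  ext t
  constructor
  · rintro ⟨a, ha, b, hb, h1, h2, h3⟩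
    exact ⟨(a, b), ⟨⟨ha, hb⟩, h1.trans h2.symm, h3⟩, h1⟩
  · rintro ⟨⟨a, b⟩, ⟨⟨ha, hb⟩, h1, h3⟩, h2⟩
    exact ⟨a, ha, b, hb, h2, h1.symm.trans h2, h3⟩

lemma sign_exists {A B : Set E2} (hAc : IsCompact A) (hBc : IsCompact B)
    (hAp : IsPreconnected A) (hBp : IsPreconnected B)
    (hA : OrthoConvex A) (hB : OrthoConvex B) (hd : Disjoint A B)
    {i j : Fin 2} (hij : j ≠ i) :
    ∃ s : ℝ, (s = 1 ∨ s = -1) ∧ ∀ a ∈ A, ∀ b ∈ B, a j = b j → s * a i < s * b i := by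
  by_contra hcon
  push Not at hcon
  obtain ⟨a, ha, b, hb, hab, h1⟩ := hcon 1 (Or.inl rfl)
  obtain ⟨a', ha', b', hb', hab', h2⟩ := hcon (-1) (Or.inr rfl)
  have hIA := (hAp.image _ (coordCont j).continuousOn).ordConnected
  have hIB := (hBp.image _ (coordCont j).continuousOn).ordConnected
  have hI := (hIA.inter hIB).isPreconnected
  have hT := closed_T hAc hBc i j
  have hT' := closed_T hBc hAc i j
  have := isPreconnected_closed_iff.1 hI _ _ hT hT' ?_ ?_ ?_
  · obtain ⟨t, _, ⟨p, hp, q, hq, e1, e2, e3⟩, ⟨q', hq', p', hp', e4, e5, e6⟩⟩ := this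
    exact no_cross hA hB hd hij hp hq hp' hq' t e1 e2 e5 e4 e3 e6
  · rintro t ⟨⟨p, hp, e1⟩, ⟨q, hq, e2⟩⟩
    rcases le_total (p i) (q i) with h | h
    · exact Or.inl ⟨p, hp, q, hq, e1, e2, h⟩
    · exact Or.inr ⟨q, hq, p, hp, e2, e1, h⟩
  · exact ⟨a' j, ⟨⟨a', ha', rfl⟩, ⟨b', hb', hab'.symm⟩⟩, a', ha', b', hb', rfl, hab'.symm,
      by linarith⟩
  · exact ⟨a j, ⟨⟨a, ha, rfl⟩, ⟨b, hb, hab.symm⟩⟩, b, hb, a, ha, hab.symm, rfl,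
      by linarith⟩

lemma quad {S : Set E2} (hS : IsPreconnected S) {s t : ℝ} (hs : s ≠ 0) (ht : t ≠ 0) (p : E2)
    (q : E2) (hq : q ∈ S) (h0 : s * q 0 ≤ s * p 0) (h1 : t * q 1 ≤ t * p 1)
    (hv : ∀ r ∈ S, r 0 = p 0 → t * p 1 < t * r 1)
    (hh : ∀ r ∈ S, r 1 = p 1 → s * p 0 < s * r 0) :
    ∀ r ∈ S, s * r 0 < s * p 0 ∧ t * r 1 < t * p 1 := by
  let g : E2 → ℝ := fun r => max (s * r 0 - s * p 0) (t * r 1 - t * p 1)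
  have hg : Continuous g := by
    apply Continuous.max <;> fun_prop
  have hne : ∀ r ∈ S, g r ≠ 0 := by
    intro r hr h
    have l0 : s * r 0 - s * p 0 ≤ 0 := h ▸ le_max_left _ _
    have l1 : t * r 1 - t * p 1 ≤ 0 := h ▸ le_max_right _ _
    rcases max_choice (s * r 0 - s * p 0) (t * r 1 - t * p 1) with h' | h'
    · have e : s * r 0 - s * p 0 = 0 := h'.symm.trans h
      have := hv r hr (mul_left_cancel₀ hs (by linarith))
      linarith
    · have e : t * r 1 - t * p 1 = 0 := h'.symm.trans h
      have := hh r hr (mul_left_cancel₀ ht (by linarith))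
      linarith
  have hgq : g q ≤ 0 := max_le (by linarith) (by linarith)
  intro r hr
  have hgr : g r < 0 := by
    by_contra hc
    obtain ⟨z, hz, hz'⟩ := hS.intermediate_value hq hr hg.continuousOn ⟨hgq, not_lt.1 hc⟩
    exact hne z hz hz'
  have := max_lt_iff.1 hgr
  constructor <;> linarith [this.1, this.2]

lemma signs {A B : Set E2} (hAc : IsCompact A) (hBc : IsCompact B)
    (hAp : IsPreconnected A) (hBp : IsPreconnected B)
    (hA : OrthoConvex A) (hB : OrthoConvex B) (hd : Disjoint A B) :
    ∃ s t : ℝ, (s = 1 ∨ s = -1) ∧ (t = 1 ∨ t = -1) ∧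
      ∀ a ∈ A, ∀ b ∈ B, s * a 0 < s * b 0 ∨ t * a 1 < t * b 1 := by
  by_cases hI : ∃ a ∈ A, ∃ b ∈ B, a 0 = b 0
  · obtain ⟨u, hu, w, hw, huw⟩ := hI
    obtain ⟨s, hs, hs'⟩ := sign_exists hAc hBc hAp hBp hA hB hd (i := 0) (j := 1) (by decide)
    obtain ⟨t, ht, ht'⟩ := sign_exists hAc hBc hAp hBp hA hB hd (i := 1) (j := 0) (by decide)
    have hs0 : s ≠ 0 := by rcases hs with h | h <;> simp [h]
    have ht0 : t ≠ 0 := by rcases ht with h | h <;> simp [h]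
    refine ⟨s, t, hs, ht, ?_⟩
    by_contra hcon
    push Not at hcon
    obtain ⟨a, ha, b, hb, h0, h1⟩ := hcon
    have k1 := quad hBp hs0 ht0 a b hb h0 h1 (fun r hr e => ht' a ha r hr e.symm)
      (fun r hr e => hs' a ha r hr e.symm) w hw
    have k2 := quad hAp (neg_ne_zero.2 hs0) (neg_ne_zero.2 ht0) w a ha (by linarith [k1.1])
      (by linarith [k1.2]) (fun r hr e => by have := ht' r hr w hw e; linarith)
      (fun r hr e => by have := hs' r hr w hw e; linarith) u hu
    rw [huw] at k2
    exact lt_irrefl _ k2.1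
  · push Not at hI
    have : ∃ s : ℝ, (s = 1 ∨ s = -1) ∧ ∀ a ∈ A, ∀ b ∈ B, s * a 0 < s * b 0 := by
      by_contra hcon
      push Not at hcon
      obtain ⟨a, ha, b, hb, h1⟩ := hcon 1 (Or.inl rfl)
      obtain ⟨a', ha', b', hb', h2⟩ := hcon (-1) (Or.inr rfl)
      have := (hAp.prod hBp).intermediate_value (a := (a', b')) (b := (a, b)) ⟨ha', hb'⟩ ⟨ha, hb⟩
        (f := fun p : E2 × E2 => p.1 0 - p.2 0) (by fun_prop)
        (show (0 : ℝ) ∈ _ from ⟨by simp only; linarith, by simp only; linarith⟩)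
      obtain ⟨⟨p, q⟩, ⟨hp, hq⟩, e⟩ := this
      exact hI p hp q hq (by simp only at e; linarith)
    obtain ⟨s, hs, h⟩ := this
    exact ⟨s, 1, hs, Or.inl rfl, fun a ha b hb => Or.inl (h a ha b hb)⟩

noncomputable def stG (x y : ℕ → ℝ) (m : ℕ) (hm : 1 ≤ m) (p : E2) : ℝ :=
  (Finset.Icc 1 m).inf' (Finset.nonempty_Icc.2 hm) (fun k => max (p 0 - x k) (p 1 - y k))

lemma stG_le {x y : ℕ → ℝ} {m : ℕ} {hm : 1 ≤ m} {p : E2} {c : ℝ} :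
    stG x y m hm p ≤ c ↔ ∃ k, 1 ≤ k ∧ k ≤ m ∧ p 0 ≤ x k + c ∧ p 1 ≤ y k + c := by
  simp only [stG, Finset.inf'_le_iff, Finset.mem_Icc, max_le_iff, sub_le_iff_le_add', and_assoc]

lemma stG_lt {x y : ℕ → ℝ} {m : ℕ} {hm : 1 ≤ m} {p : E2} {c : ℝ} :
    stG x y m hm p < c ↔ ∃ k, 1 ≤ k ∧ k ≤ m ∧ p 0 < x k + c ∧ p 1 < y k + c := by
  simp only [stG, Finset.inf'_lt_iff, Finset.mem_Icc, max_lt_iff, sub_lt_iff_lt_add', and_assoc]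

lemma stG_cont (x y : ℕ → ℝ) (m : ℕ) (hm : 1 ≤ m) : Continuous (stG x y m hm) := by
  unfold stG
  apply Continuous.finset_inf'_apply
  intro k _
  apply Continuous.max <;> fun_prop

lemma stG_shift (x y : ℕ → ℝ) (m : ℕ) (hm : 1 ≤ m) (p : E2) (s : ℝ) :
    stG x y m hm (p + s • !₂[1, 1]) = stG x y m hm p + s := by
  apply eq_of_forall_ge_iff
  intro c
  rw [← le_sub_iff_add_le, stG_le, stG_le]
  simp [← le_sub_iff_add_le, add_sub_assoc]

lemma ray_left (p : E2) (c d : ℝ) (e : ℝ) (he : e < c) :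
    p ∈ Ray !₂[c, d] !₂[e, d] ↔ p 0 ≤ c ∧ p 1 = d := by
  constructor
  · rintro ⟨t, ht, rfl⟩
    simp
    nlinarith
  · rintro ⟨h0, h1⟩
    refine ⟨(c - p 0) / (c - e), div_nonneg (by linarith) (by linarith), ?_⟩
    have : c - e ≠ 0 := by linarith
    ext k
    fin_cases k
    · simp; field_simp; ring
    · simp [h1]

lemma ray_down (p : E2) (c d : ℝ) (e : ℝ) (he : e < d) :
    p ∈ Ray !₂[c, d] !₂[c, e] ↔ p 0 = c ∧ p 1 ≤ d := by
  constructor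
  · rintro ⟨t, ht, rfl⟩
    simp
    nlinarith
  · rintro ⟨h0, h1⟩
    refine ⟨(d - p 1) / (d - e), div_nonneg (by linarith) (by linarith), ?_⟩
    have : d - e ≠ 0 := by linarith
    ext k
    fin_cases k
    · simp [h0]
    · simp; field_simp; ring

lemma seg_h (p : E2) (c e d : ℝ) (he : c < e) :
    p ∈ segment ℝ (!₂[c, d] : E2) !₂[e, d] ↔ p 1 = d ∧ c ≤ p 0 ∧ p 0 ≤ e := by
  rw [segment_eq_image']
  constructor
  · rintro ⟨t, ⟨h0, h1⟩, rfl⟩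
    simp
    constructor <;> nlinarith
  · rintro ⟨h1, h0, h2⟩
    have : e - c ≠ 0 := by linarith
    refine ⟨(p 0 - c) / (e - c), ⟨div_nonneg (by linarith) (by linarith),
      (div_le_one (by linarith)).2 (by linarith)⟩, ?_⟩
    ext k
    fin_cases k
    · simp; field_simp; ring
    · simp [h1]

lemma seg_v (p : E2) (c d e : ℝ) (he : e < d) :
    p ∈ segment ℝ (!₂[c, d] : E2) !₂[c, e] ↔ p 0 = c ∧ e ≤ p 1 ∧ p 1 ≤ d := by
  rw [segment_eq_image']
  constructor
  · rintro ⟨t, ⟨h0, h1⟩, rfl⟩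
    simp
    constructor <;> nlinarith
  · rintro ⟨h1, h0, h2⟩
    have : d - e ≠ 0 := by linarith
    refine ⟨(d - p 1) / (d - e), ⟨div_nonneg (by linarith) (by linarith),
      (div_le_one (by linarith)).2 (by linarith)⟩, ?_⟩
    ext k
    fin_cases k
    · simp [h1]
    · simp; field_simp; ring

noncomputable def stV (x y : ℕ → ℝ) (i : ℕ) : E2 := !₂[x ((i + 1) / 2), y (i / 2 + 1)]

lemma stV_even (x y : ℕ → ℝ) (k : ℕ) : stV x y (2 * k) = !₂[x k, y (k + 1)] := by
  unfold stV
  rw [show (2 * k + 1) / 2 = k by omega, show (2 * k) / 2 = k by omega]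

lemma stV_odd (x y : ℕ → ℝ) (k : ℕ) : stV x y (2 * k + 1) = !₂[x (k + 1), y (k + 1)] := by
  unfold stV
  rw [show (2 * k + 1 + 1) / 2 = k + 1 by omega, show (2 * k + 1) / 2 = k by omega]

lemma st_set {x y : ℕ → ℝ} (hx : StrictMono x) (hy : StrictAnti y) (m : ℕ) (hm : 1 ≤ m) :
    {p | stG x y m hm p = 0} = Ray (stV x y 1) (stV x y 0) ∪
      Ray (stV x y (2 * m - 1)) (stV x y (2 * m)) ∪
      ⋃ i ∈ Set.Ico 1 (2 * m - 1), segment ℝ (stV x y i) (stV x y (i + 1)) := by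
  have r1 : ∀ p, p ∈ Ray (stV x y 1) (stV x y 0) ↔ p 0 ≤ x 1 ∧ p 1 = y 1 := by
    intro p
    rw [show stV x y 1 = _ from stV_odd x y 0, show stV x y 0 = _ from stV_even x y 0]
    exact ray_left _ _ _ _ (hx (by norm_num))
  have r2 : ∀ p, p ∈ Ray (stV x y (2 * m - 1)) (stV x y (2 * m)) ↔ p 0 = x m ∧ p 1 ≤ y m := by
    intro p
    obtain ⟨l, rfl⟩ : ∃ l, m = l + 1 := ⟨m - 1, by omega⟩
    rw [show 2 * (l + 1) - 1 = 2 * l + 1 by omega, stV_odd, stV_even]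
    exact ray_down _ _ _ _ (hy (by omega))
  have s1 : ∀ p k, p ∈ segment ℝ (stV x y (2 * k + 1)) (stV x y (2 * k + 1 + 1)) ↔
      p 0 = x (k + 1) ∧ y (k + 2) ≤ p 1 ∧ p 1 ≤ y (k + 1) := by
    intro p k
    rw [show 2 * k + 1 + 1 = 2 * (k + 1) by ring, stV_odd, stV_even]
    exact seg_v _ _ _ _ (hy (by omega))
  have s2 : ∀ p k, p ∈ segment ℝ (stV x y (2 * k)) (stV x y (2 * k + 1)) ↔
      p 1 = y (k + 1) ∧ x k ≤ p 0 ∧ p 0 ≤ x (k + 1) := by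
    intro p k
    rw [stV_odd, stV_even]
    exact seg_h _ _ _ _ (hx (by omega))
  ext p
  have hiff : p ∈ {p | stG x y m hm p = 0} ↔ (∃ k, 1 ≤ k ∧ k ≤ m ∧ p 0 ≤ x k ∧ p 1 ≤ y k) ∧
      ∀ k, 1 ≤ k → k ≤ m → x k ≤ p 0 ∨ y k ≤ p 1 := by
    rw [Set.mem_ofPred_eq, eq_iff_le_not_lt, stG_le, stG_lt]
    simp only [add_zero]
    push Not
    refine and_congr_right fun _ => ?_
    refine forall_congr' fun k => forall_congr' fun _ => forall_congr' fun _ => ?_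
    rw [← not_lt, ← not_lt, ← imp_iff_not_or]
  rw [hiff]
  simp only [Set.mem_union, r1, r2, Set.mem_iUnion, exists_prop, Set.mem_Ico]
  constructor
  · rintro ⟨⟨k, k1, k2, hk0, hk1⟩, hall⟩
    rcases hall k k1 k2 with h | h
    · have e : p 0 = x k := le_antisymm hk0 h
      rcases k2.eq_or_lt with rfl | hlt
      · exact Or.inl (Or.inr ⟨e, hk1⟩)
      · obtain ⟨l, rfl⟩ : ∃ l, k = l + 1 := ⟨k - 1, by omega⟩
        refine Or.inr ⟨2 * l + 1, by omega, (s1 p l).2 ⟨e, ?_, hk1⟩⟩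
        rcases hall (l + 2) (by omega) (by omega) with h' | h'
        · have := hx (show l + 1 < l + 2 by omega)
          linarith
        · exact h'
    · have e : p 1 = y k := le_antisymm hk1 h
      rcases k1.eq_or_lt with rfl | hlt
      · exact Or.inl (Or.inl ⟨hk0, e⟩)
      · obtain ⟨l, rfl⟩ : ∃ l, k = l + 1 := ⟨k - 1, by omega⟩
        refine Or.inr ⟨2 * l, by omega, (s2 p l).2 ⟨e, ?_, hk0⟩⟩
        rcases hall l (by omega) (by omega) with h' | h'
        · exact h'
        · have := hy (show l < l + 1 by omega)
          linarith
  · rintro ((⟨h0, h1⟩ | ⟨h0, h1⟩) | ⟨i, hi, hp⟩)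
    · refine ⟨⟨1, le_rfl, hm, h0, h1.le⟩, fun k k1 k2 => Or.inr ?_⟩
      rw [h1]; exact hy.antitone k1
    · refine ⟨⟨m, hm, le_rfl, h0.le, h1⟩, fun k k1 k2 => Or.inl ?_⟩
      rw [h0]; exact hx.monotone k2
    · rcases Nat.even_or_odd' i with ⟨l, rfl | rfl⟩
      · obtain ⟨e, h1, h2⟩ := (s2 p l).1 hp
        refine ⟨⟨l + 1, by omega, by omega, h2, e.le⟩, fun k k1 k2 => ?_⟩
        rcases Nat.lt_or_ge l k with h | h
        · right; rw [e]; exact hy.antitone h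
        · left; exact (hx.monotone h).trans h1
      · obtain ⟨e, h1, h2⟩ := (s1 p l).1 hp
        refine ⟨⟨l + 1, by omega, by omega, e.le, h2⟩, fun k k1 k2 => ?_⟩
        rcases Nat.lt_or_ge (l + 1) k with h | h
        · right; exact (hy.antitone h).trans h1
        · left; rw [e]; exact hx.monotone h

lemma st_line {x y : ℕ → ℝ} (hx : StrictMono x) (hy : StrictAnti y) (m : ℕ) (hm : 1 ≤ m) :
    IsStaircaseLine {p | stG x y m hm p = 0} := by
  refine ⟨2 * m, stV x y, by omega, ?_, ?_, ?_, st_set hx hy m hm⟩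
  · intro i h1 h2
    obtain ⟨j, rfl⟩ : ∃ j, i = j + 1 := ⟨i - 1, by omega⟩
    rw [Nat.add_sub_cancel]
    rcases Nat.even_or_odd' j with ⟨l, rfl | rfl⟩
    · rw [stV_odd, stV_even]
      refine ⟨fun h => ?_, Or.inr rfl⟩
      have := congrArg (fun p : E2 => p 0) h
      exact (hx (Nat.lt_succ_self l)).ne this
    · rw [show 2 * l + 1 + 1 = 2 * (l + 1) by ring, stV_odd, stV_even]
      refine ⟨fun h => ?_, Or.inl rfl⟩
      have := congrArg (fun p : E2 => p 1) h
      exact (hy (Nat.lt_succ_self (l + 1))).ne this.symm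
  · intro i j h1 h2 h3 h4 hij
    obtain ⟨i, rfl⟩ : ∃ j, i = j + 1 := ⟨i - 1, by omega⟩
    obtain ⟨j, rfl⟩ : ∃ i, j = i + 1 := ⟨j - 1, by omega⟩
    rw [Nat.add_sub_cancel, Nat.add_sub_cancel]
    rcases Nat.even_or_odd' i with ⟨l, rfl | rfl⟩
    · obtain ⟨k, rfl⟩ : ∃ k, j = 2 * k := ⟨j / 2, by omega⟩
      simp only [stV_odd, stV_even]
      have a1 := hx (Nat.lt_succ_self l)
      have a2 := hx (Nat.lt_succ_self k)
      simp only [Nat.succ_eq_add_one] at a1 a2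
      have a3 : x (l + 1) - x l ≠ 0 := by linarith
      refine ⟨(x (k + 1) - x k) / (x (l + 1) - x l), div_pos (by linarith) (by linarith), ?_⟩
      ext r
      fin_cases r
      · simp; field_simp
      · simp
    · obtain ⟨k, rfl⟩ : ∃ k, j = 2 * k + 1 := ⟨j / 2, by omega⟩
      rw [show 2 * l + 1 + 1 = 2 * (l + 1) by ring, show 2 * k + 1 + 1 = 2 * (k + 1) by ring]
      simp only [stV_odd, stV_even]
      have a1 := hy (Nat.lt_succ_self (l + 1))
      have a2 := hy (Nat.lt_succ_self (k + 1))
      simp only [Nat.succ_eq_add_one] at a1 a2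
      have a3 : y (l + 1 + 1) - y (l + 1) ≠ 0 := by linarith
      refine ⟨(y (k + 1 + 1) - y (k + 1)) / (y (l + 1 + 1) - y (l + 1)),
        div_pos_of_neg_of_neg (by linarith) (by linarith), ?_⟩
      ext r
      fin_cases r
      · simp
      · simp; field_simp
  · have hG := stG_cont x y m hm
    have hpc : Continuous (fun u : ℝ => (!₂[u, 0] : E2)) := by fun_prop
    refine ⟨fun u => !₂[u, 0] + (-(stG x y m hm !₂[u, 0])) • !₂[1, 1], ?_, ?_, ?_⟩
    · have := hG.comp hpc
      simp only [Function.comp_def] at this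
      fun_prop
    · intro u u' h
      have h0 := congrArg (fun p : E2 => p 0) h
      have h1 := congrArg (fun p : E2 => p 1) h
      simp at h0 h1
      linarith
    · ext p
      constructor
      · rintro ⟨u, rfl⟩
        simp only [Set.mem_ofPred_eq]
        rw [stG_shift]; ring
      · intro hp
        refine ⟨p 0 - p 1, ?_⟩
        have e : (!₂[p 0 - p 1, 0] : E2) = p + (-(p 1)) • !₂[1, 1] := by
          ext k
          fin_cases k
          · simp; ring
          · simp
        simp only
        rw [e, stG_shift, show stG x y m hm p = 0 from hp]
        ext k
        fin_cases k <;> simp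

lemma st_sep {x y : ℕ → ℝ} (hx : StrictMono x) (hy : StrictAnti y) (m : ℕ) (hm : 1 ≤ m)
    {A B : Set E2} (hA : ∀ a ∈ A, stG x y m hm a < 0) (hB : ∀ b ∈ B, 0 < stG x y m hm b) :
    StrictlySeparates {p | stG x y m hm p = 0} A B := by
  have hL := st_line hx hy m hm
  have hG := stG_cont x y m hm
  have hsc : ∀ p : E2, Continuous (fun s : ℝ => p + s • (!₂[1, 1] : E2)) := fun p => by fun_prop
  have f1 : frontier {p | stG x y m hm p ≤ 0} = {p | stG x y m hm p = 0} := by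
    apply subset_antisymm (frontier_le_subset_eq hG continuous_const)
    intro p hp
    rw [Set.mem_ofPred_eq] at hp
    rw [frontier_eq_closure_inter_closure]
    refine ⟨subset_closure hp.le, ?_⟩
    have h0 : (fun s : ℝ => p + s • (!₂[1, 1] : E2)) 0 = p := by simp
    have h1 : (0 : ℝ) ∈ closure (Set.Ioi (0 : ℝ)) := by simp
    rw [← h0]
    refine map_mem_closure (f := fun s : ℝ => p + s • (!₂[1, 1] : E2)) (hsc p) h1 ?_
    intro s hs
    simp only [Set.mem_compl_iff, Set.mem_ofPred_eq, not_le, stG_shift, hp]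
    simpa using hs
  have f2 : frontier {p | 0 ≤ stG x y m hm p} = {p | stG x y m hm p = 0} := by
    apply subset_antisymm
    · intro p hp
      exact (frontier_le_subset_eq continuous_const hG hp).symm
    intro p hp
    rw [Set.mem_ofPred_eq] at hp
    rw [frontier_eq_closure_inter_closure]
    refine ⟨subset_closure hp.ge, ?_⟩
    have h0 : (fun s : ℝ => p + s • (!₂[1, 1] : E2)) 0 = p := by simp
    have h1 : (0 : ℝ) ∈ closure (Set.Iio (0 : ℝ)) := by simp
    rw [← h0]
    refine map_mem_closure (f := fun s : ℝ => p + s • (!₂[1, 1] : E2)) (hsc p) h1 ?_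
    intro s hs
    simp only [Set.mem_compl_iff, Set.mem_ofPred_eq, not_le, stG_shift, hp]
    simpa using hs
  refine ⟨hL, {p | stG x y m hm p ≤ 0}, {p | 0 ≤ stG x y m hm p},
    ⟨isClosed_le hG continuous_const, f1 ▸ hL⟩, ⟨isClosed_le continuous_const hG, f2 ▸ hL⟩,
    f1, f2, ?_, fun a ha => (hA a ha).le, fun b hb => (hB b hb).le, ?_, ?_⟩
  · ext p; simp [le_total]
  · exact Set.disjoint_left.2 fun a ha h => (hA a ha).ne h
  · exact Set.disjoint_left.2 fun a ha h => (hB a ha).ne' h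

lemma sep_basic {A B : Set E2} (hAne : A.Nonempty) (hBne : B.Nonempty)
    (hAc : IsCompact A) (hBc : IsCompact B)
    (h : ∀ a ∈ A, ∀ b ∈ B, a 0 < b 0 ∨ a 1 < b 1) :
    ∃ L, StrictlySeparates L A B := by
  -- the gap
  obtain ⟨ε, hε, hgap⟩ : ∃ ε : ℝ, 0 < ε ∧
      ∀ a ∈ A, ∀ b ∈ B, a 0 + ε < b 0 ∨ a 1 + ε < b 1 := by
    obtain ⟨⟨a, b⟩, ⟨ha, hb⟩, hmin⟩ := (hAc.prod hBc).exists_isMinOn (hAne.prod hBne)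
      (f := fun p : E2 × E2 => max (p.2 0 - p.1 0) (p.2 1 - p.1 1))
      (Continuous.max (by fun_prop) (by fun_prop)).continuousOn
    have hpos : 0 < max (b 0 - a 0) (b 1 - a 1) := by
      rw [lt_max_iff]
      rcases h a ha b hb with h | h
      · left; linarith
      · right; linarith
    refine ⟨max (b 0 - a 0) (b 1 - a 1) / 2, by linarith, fun a' ha' b' hb' => ?_⟩
    have : max (b 0 - a 0) (b 1 - a 1) ≤ max (b' 0 - a' 0) (b' 1 - a' 1) :=
      hmin (show (a', b') ∈ A ×ˢ B from ⟨ha', hb'⟩)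
    rcases le_max_iff.1 this with h | h
    · left; linarith
    · right; linarith
  obtain ⟨aM, haM, hM⟩ := hAc.exists_isMaxOn hAne (coordCont 0).continuousOn
  obtain ⟨am, ham, hmi⟩ := hAc.exists_isMinOn hAne (coordCont 0).continuousOn
  set X := aM 0 with hX
  have hM : ∀ a ∈ A, a 0 ≤ X := fun a ha => hM ha
  have hmi : ∀ a ∈ A, am 0 ≤ a 0 := fun a ha => hmi ha
  -- height function
  obtain ⟨f, hf⟩ : ∃ f : ℝ → ℝ, ∀ t ≤ X, (∃ a ∈ A, t ≤ a 0 ∧ a 1 = f t) ∧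
      ∀ a ∈ A, t ≤ a 0 → a 1 ≤ f t := by
    have : ∀ t : ℝ, ∃ z : ℝ, t ≤ X → (∃ a ∈ A, t ≤ a 0 ∧ a 1 = z) ∧
        ∀ a ∈ A, t ≤ a 0 → a 1 ≤ z := by
      intro t
      by_cases ht : t ≤ X
      · have hc : IsCompact (A ∩ {p : E2 | t ≤ p 0}) :=
          hAc.inter_right (isClosed_le continuous_const (coordCont 0))
        obtain ⟨a, ⟨ha, ha'⟩, hmax⟩ := hc.exists_isMaxOn ⟨aM, haM, ht⟩ (coordCont 1).continuousOn
        exact ⟨a 1, fun _ => ⟨⟨a, ha, ha', rfl⟩, fun b hb hb' => hmax ⟨hb, hb'⟩⟩⟩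
      · exact ⟨0, fun h => absurd h ht⟩
    choose f hf using this
    exact ⟨f, hf⟩
  have fanti : ∀ t t' : ℝ, t ≤ t' → t' ≤ X → f t' ≤ f t := by
    intro t t' h1 h2
    obtain ⟨a, ha, h3, h4⟩ := (hf t' h2).1
    rw [← h4]
    exact (hf t (h1.trans h2)).2 a ha (h1.trans h3)
  obtain ⟨m0, hm0⟩ := exists_nat_ge ((X - am 0) / ε)
  rw [div_le_iff₀ hε] at hm0
  set m := m0 + 1 with hmdef
  have hmp : (0 : ℝ) < (m : ℝ) + 1 := by positivity
  let x : ℕ → ℝ := fun k => X + ((k : ℝ) + 1 - m) * ε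
  let y : ℕ → ℝ := fun k => f (min (X + ((k : ℝ) - m) * ε) X) + ε * (1 - k / ((m : ℝ) + 1))
  have hx : StrictMono x := by
    apply strictMono_nat_of_lt_succ
    intro k
    simp only [x]; push_cast; nlinarith
  have hy : StrictAnti y := by
    apply strictAnti_nat_of_succ_lt
    intro k
    simp only [y]
    apply add_lt_add_of_le_of_lt
    · apply fanti _ _ _ (min_le_right _ _)
      apply min_le_min_right
      push_cast; nlinarith
    · apply mul_lt_mul_of_pos_left _ hε
      apply sub_lt_sub_left
      apply div_lt_div_of_pos_right _ hmp
      push_cast; linarith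
  have hm : 1 ≤ m := by omega
  have ysmall : ∀ k : ℕ, k ≤ m → f (X + ((k : ℝ) - m) * ε) < y k ∧
      y k ≤ f (X + ((k : ℝ) - m) * ε) + ε ∧ X + ((k : ℝ) - m) * ε ≤ X := by
    intro k hk
    have hk' : (k : ℝ) ≤ m := by exact_mod_cast hk
    have hle : X + ((k : ℝ) - m) * ε ≤ X := by nlinarith
    have q0 : 0 ≤ (k : ℝ) / ((m : ℝ) + 1) := by positivity
    have q1 : (k : ℝ) / ((m : ℝ) + 1) < 1 := by rw [div_lt_one hmp]; linarith
    simp only [y, min_eq_left hle]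
    refine ⟨?_, ?_, hle⟩ <;> nlinarith
  refine ⟨_, st_sep hx hy m hm ?_ ?_⟩
  · intro a ha
    rw [stG_lt]
    have hex : ∃ k, a 0 < x k := ⟨m, by simp only [x]; have := hM a ha; nlinarith⟩
    classical
    have hk := Nat.find_spec hex
    have hkm : Nat.find hex ≤ m := Nat.find_min' hex (by simp only [x]; have := hM a ha; nlinarith)
    have hmn := fun j => Nat.find_min hex (m := j)
    generalize Nat.find hex = k at hk hkm hmn
    have hk0 : k ≠ 0 := by
      rintro rfl
      simp only [x, hmdef] at hk
      push_cast at hk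
      have := hmi a ha
      nlinarith
    obtain ⟨l, rfl⟩ : ∃ l, k = l + 1 := ⟨k - 1, by omega⟩
    have hl := not_lt.1 (hmn l (by omega))
    obtain ⟨y1, y2, y3⟩ := ysmall (l + 1) hkm
    refine ⟨l + 1, by omega, hkm, by linarith, ?_⟩
    have := (hf _ y3).2 a ha (by simp only [x] at hl; push_cast; linarith)
    linarith
  · intro b hb
    rw [← not_le, stG_le]
    rintro ⟨k, k1, k2, h0, h1⟩
    obtain ⟨y1, y2, y3⟩ := ysmall k k2
    obtain ⟨a, ha, h3, h4⟩ := (hf _ y3).1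
    simp only [x] at h0
    rcases hgap a ha b hb with h | h <;> linarith

/-- Coordinate reflection. -/
noncomputable def refl2 (s t : ℝ) (hs : s = 1 ∨ s = -1) (ht : t = 1 ∨ t = -1) : E2 ≃L[ℝ] E2 :=
  (LinearEquiv.ofInvolutive
    ({ toFun := fun p => !₂[s * p 0, t * p 1]
       map_add' := fun p q => by ext k; fin_cases k <;> simp [mul_add]
       map_smul' := fun c p => by ext k; fin_cases k <;> simp [mul_left_comm] } : E2 →ₗ[ℝ] E2)
    (fun p => by
      have hs' : s * s = 1 := by rcases hs with h | h <;> simp [h]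
      have ht' : t * t = 1 := by rcases ht with h | h <;> simp [h]
      ext k
      fin_cases k <;> simp [← mul_assoc, hs', ht'])).toContinuousLinearEquiv

lemma refl2_apply (s t : ℝ) (hs : s = 1 ∨ s = -1) (ht : t = 1 ∨ t = -1) (p : E2) :
    refl2 s t hs ht p = !₂[s * p 0, t * p 1] := rfl

lemma ray_image (e : E2 ≃L[ℝ] E2) (p q : E2) : e '' Ray p q = Ray (e p) (e q) := by
  ext z
  constructor
  · rintro ⟨_, ⟨t, ht, rfl⟩, rfl⟩
    exact ⟨t, ht, by simp⟩
  · rintro ⟨t, ht, rfl⟩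
    exact ⟨p + t • (q - p), ⟨t, ht, rfl⟩, by simp⟩

lemma line_image (s t : ℝ) (hs : s = 1 ∨ s = -1) (ht : t = 1 ∨ t = -1) {L : Set E2}
    (hL : IsStaircaseLine L) : IsStaircaseLine (refl2 s t hs ht '' L) := by
  obtain ⟨n, v, hn, h1, h2, ⟨φ, c1, c2, c3⟩, h4⟩ := hL
  refine ⟨n, fun i => refl2 s t hs ht (v i), hn, ?_, ?_, ?_, ?_⟩
  · intro i i1 i2
    obtain ⟨g1, g2⟩ := h1 i i1 i2
    refine ⟨fun h => g1 ((refl2 s t hs ht).injective h), ?_⟩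
    rcases g2 with g | g
    · left; simp [refl2_apply, g]
    · right; simp [refl2_apply, g]
  · intro i j i1 i2 j1 j2 hij
    obtain ⟨c, hc, e⟩ := h2 i j i1 i2 j1 j2 hij
    refine ⟨c, hc, ?_⟩
    simp only [← map_sub, ← map_smul, e]
  · refine ⟨fun u => refl2 s t hs ht (φ u), (refl2 s t hs ht).continuous.comp c1,
      (refl2 s t hs ht).injective.comp c2, ?_⟩
    rw [← c3, ← Set.range_comp]; rfl
  · rw [h4, Set.image_union, Set.image_union, ray_image, ray_image, Set.image_iUnion₂]
    congr 1
    refine Set.iUnion₂_congr fun i _ => ?_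
    exact image_segment ℝ (refl2 s t hs ht).toLinearMap.toAffineMap _ _

lemma sep_image (s t : ℝ) (hs : s = 1 ∨ s = -1) (ht : t = 1 ∨ t = -1) {L A B : Set E2}
    (h : StrictlySeparates L A B) :
    StrictlySeparates (refl2 s t hs ht '' L) (refl2 s t hs ht '' A) (refl2 s t hs ht '' B) := by
  obtain ⟨hL, H₁, H₂, ⟨a1, a2⟩, ⟨b1, b2⟩, f1, f2, hu, hA, hB, dA, dB⟩ := h
  have fr : ∀ H, frontier (refl2 s t hs ht '' H) = refl2 s t hs ht '' frontier H := fun H =>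
    ((refl2 s t hs ht).toHomeomorph.image_frontier H).symm
  have cl : ∀ H, IsClosed H → IsClosed (refl2 s t hs ht '' H) := fun H hH =>
    (refl2 s t hs ht).toHomeomorph.isClosedMap H hH
  have hL' := line_image s t hs ht hL
  have inj := (refl2 s t hs ht).injective
  refine ⟨hL', _, _, ⟨cl _ a1, ?_⟩, ⟨cl _ b1, ?_⟩, ?_, ?_, ?_, Set.image_mono hA,
    Set.image_mono hB, (Set.disjoint_image_iff inj).2 dA, (Set.disjoint_image_iff inj).2 dB⟩
  · rw [fr, f1]; exact hL'
  · rw [fr, f2]; exact hL'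
  · rw [fr, f1]
  · rw [fr, f2]
  · rw [← Set.image_union, hu, Set.image_univ, (refl2 s t hs ht).surjective.range_eq]

/-- If `A` and `B` are disjoint nonempty compact, path-connected, and
orthogonally convex subsets of `ℝ²`, then some staircase line strictly
separates `A` and `B`. -/
theorem staircase_separation_sets (A B : Set (EuclideanSpace ℝ (Fin 2)))
    (hAne : A.Nonempty) (hBne : B.Nonempty)
    (hAcp : IsCompact A) (hBcp : IsCompact B)
    (hApc : IsPathConnected A) (hBpc : IsPathConnected B)
    (hAoc : OrthoConvex A) (hBoc : OrthoConvex B)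
    (hdisj : Disjoint A B) :
    ∃ L : Set (EuclideanSpace ℝ (Fin 2)), StrictlySeparates L A B := by
  obtain ⟨s, t, hs, ht, h⟩ := signs hAcp hBcp hApc.isConnected.isPreconnected
    hBpc.isConnected.isPreconnected hAoc hBoc hdisj
  have hinv : ∀ S : Set (EuclideanSpace ℝ (Fin 2)),
      refl2 s t hs ht '' (refl2 s t hs ht '' S) = S := by
    intro S
    have hs' : s * s = 1 := by rcases hs with h | h <;> simp [h]
    have ht' : t * t = 1 := by rcases ht with h | h <;> simp [h]
    have : ∀ p, refl2 s t hs ht (refl2 s t hs ht p) = p := by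
      intro p
      ext k
      fin_cases k <;> simp [refl2_apply, ← mul_assoc, hs', ht']
    rw [Set.image_image]
    simp only [this, Set.image_id']
  obtain ⟨L, hL⟩ := sep_basic (hAne.image (refl2 s t hs ht)) (hBne.image (refl2 s t hs ht))
    (hAcp.image (refl2 s t hs ht).continuous) (hBcp.image (refl2 s t hs ht).continuous) (by
      rintro _ ⟨a, ha, rfl⟩ _ ⟨b, hb, rfl⟩
      simpa [refl2_apply] using h a ha b hb)
  have := sep_image s t hs ht hL
  rw [hinv, hinv] at this
  exact ⟨_, this⟩
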